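/- Let X be a noetherian topological space. Then the colimit of any filtered diagram of flabby (flasque) sheaves of abelian groups on X is again a flabby sheaf. -/

import Mathlib

open CategoryTheory CategoryTheory.Limits TopologicalSpace

/-- A sheaf of abelian groups is flabby (flasque) if for every open `U` the restriction map
from global sections `F(X) → F(U)` is surjective. -/
def IsFlabby {X : TopCat} (F : TopCat.Sheaf Ab X) : Prop :=
  ∀ U : Opens X, Function.Surjective (F.val.map (homOfLE (le_top : U ≤ ⊤)).op)

section

open Opposite TopCat

universe v₁ u₁ u w

namespace TopCat

/-- The unique gluing criterion for sheaves of abelian groups, without universe restrictions. -/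
theorem Presheaf.isSheaf_iff_isSheafUniqueGluing_ab {X : TopCat.{u}}
    (P : Presheaf AddCommGrpCat.{w} X) : P.IsSheaf ↔ P.IsSheafUniqueGluing := by
  constructor
  · intro h ι U sf hsf
    exact ((isSheaf_iff_isSheafUniqueGluing_types _).1
      (CategoryTheory.Presheaf.isSheaf_comp_of_isSheaf _ P (forget _) h)) U sf hsf
  · intro h
    refine CategoryTheory.Presheaf.isSheaf_of_isSheaf_comp _ P AddCommGrpCat.uliftFunctor.{u, w} ?_
    refine (isSheaf_iff_isSheafUniqueGluing
      (P ⋙ AddCommGrpCat.uliftFunctor.{u, w} : Presheaf AddCommGrpCat.{max u w} X)).2 ?_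
    intro ι U sf hsf
    obtain ⟨s, hs, hs'⟩ := h U (fun i => (sf i).down)
      (fun i j => congrArg ULift.down (hsf i j))
    exact ⟨ULift.up s, fun i => congrArg ULift.up (hs i),
      fun t ht => congrArg ULift.up (hs' t.down fun i => congrArg ULift.down (ht i))⟩

variable {X : TopCat.{u}}

namespace Sheaf

variable (F : Sheaf AddCommGrpCat.{w} X)

theorem map_map_apply {U V W : Opens X} (i : V ⟶ U) (j : W ⟶ V) (k : W ⟶ U)
    (s : F.obj.obj (op U)) : F.obj.map j.op (F.obj.map i.op s) = F.obj.map k.op s := by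
  rw [← ConcreteCategory.comp_apply, ← F.obj.map_comp]
  rfl

theorem map_self_apply {U : Opens X} (i : U ⟶ U)
    (s : F.obj.obj (op U)) : F.obj.map i.op s = s := by
  obtain rfl : i = 𝟙 U := rfl
  simp

theorem naturality_hom_apply {F G : Sheaf AddCommGrpCat.{w} X} (f : F ⟶ G) {U V : Opens X}
    (i : V ⟶ U) (s : F.obj.obj (op U)) :
    f.hom.app (op V) (F.obj.map i.op s) = G.obj.map i.op (f.hom.app (op U) s) :=
  NatTrans.naturality_apply f.hom i.op s

theorem existsUnique_gluing_ab {ι : Type u} (U : ι → Opens X) (V : Opens X) (iUV : ∀ i, U i ⟶ V)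
    (hV : V ≤ iSup U) (sf : ∀ i, F.obj.obj (op (U i)))
    (h : ∀ i j, F.obj.map (homOfLE (inf_le_left : U i ⊓ U j ≤ U i)).op (sf i) =
      F.obj.map (homOfLE (inf_le_right : U i ⊓ U j ≤ U j)).op (sf j)) :
    ∃! s : F.obj.obj (op V), ∀ i, F.obj.map (iUV i).op s = sf i := by
  obtain rfl : V = iSup U := le_antisymm hV (iSup_le fun i => (iUV i).le)
  exact (Presheaf.isSheaf_iff_isSheafUniqueGluing_ab _).1 F.property U sf h

theorem eq_of_locally_eq_ab {ι : Type u} (U : ι → Opens X) (V : Opens X) (iUV : ∀ i, U i ⟶ V)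
    (hV : V ≤ iSup U) (s t : F.obj.obj (op V))
    (h : ∀ i, F.obj.map (iUV i).op s = F.obj.map (iUV i).op t) : s = t := by
  refine (F.existsUnique_gluing_ab U V iUV hV (fun i => F.obj.map (iUV i).op t) ?_).unique h
    fun _ => rfl
  intro i j
  rw [F.map_map_apply _ _ (homOfLE inf_le_left ≫ iUV i),
    F.map_map_apply _ _ (homOfLE inf_le_left ≫ iUV i)]

variable {F}

/-- The presheaf of subgroups of a sheaf cut out by a restriction-stable family of subgroups. -/
def subPresheaf (S : ∀ U : Opens X, AddSubgroup (F.obj.obj (op U)))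
    (hS : ∀ {U V : Opens X} (i : V ⟶ U), ∀ t ∈ S U, F.obj.map i.op t ∈ S V) :
    Presheaf AddCommGrpCat.{w} X where
  obj U := AddCommGrpCat.of (S U.unop)
  map {U V} i := AddCommGrpCat.ofHom
    (((F.obj.map i).hom.comp (S U.unop).subtype).codRestrict (S V.unop)
      fun t => hS i.unop t.1 t.2)
  map_id U := by
    ext t
    exact F.map_self_apply (𝟙 U.unop) t.1
  map_comp {U V W} i j := by
    ext t
    exact (F.map_map_apply i.unop j.unop (j.unop ≫ i.unop) t.1).symm

/-- The subsheaf cut out by a restriction-stable local family of subgroups. -/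
def subSheaf (S : ∀ U : Opens X, AddSubgroup (F.obj.obj (op U)))
    (hS : ∀ {U V : Opens X} (i : V ⟶ U), ∀ t ∈ S U, F.obj.map i.op t ∈ S V)
    (hloc : ∀ (U : Opens X) (t : F.obj.obj (op U)),
      (∀ x ∈ U, ∃ (V : Opens X) (i : V ⟶ U), x ∈ V ∧ F.obj.map i.op t ∈ S V) → t ∈ S U) :
    Sheaf AddCommGrpCat.{w} X where
  obj := subPresheaf S hS
  property := by
    refine (Presheaf.isSheaf_iff_isSheafUniqueGluing_ab _).2 fun ι U sf hsf => ?_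
    obtain ⟨s, hs, hs'⟩ := F.existsUnique_gluing_ab U (iSup U) (Opens.leSupr U) le_rfl
      (fun i => (sf i).1) (fun i j => congrArg Subtype.val (hsf i j))
    refine ⟨⟨s, hloc _ s fun x hx => ?_⟩, fun i => Subtype.ext (hs i),
      fun t ht => Subtype.ext (hs' t.1 fun i => congrArg Subtype.val (ht i))⟩
    obtain ⟨i, hi⟩ := Opens.mem_iSup.1 hx
    exact ⟨U i, Opens.leSupr U i, hi, (hs i).symm ▸ (sf i).2⟩

/-- The skyscraper sheaf at `x` with value `A`. -/
def skyscraper (x : X) (A : Type w) [AddCommGroup A] : Sheaf AddCommGrpCat.{w} X where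
  obj :=
    { obj U := AddCommGrpCat.of (PLift (x ∈ U.unop) → A)
      map i := AddCommGrpCat.ofHom
        { toFun s h := s ⟨i.unop.le h.down⟩
          map_zero' := rfl
          map_add' _ _ := rfl } }
  property := by
    refine (Presheaf.isSheaf_iff_isSheafUniqueGluing_ab _).2 fun ι U sf hsf => ?_
    have key (h : x ∈ iSup U) : ∃ i, x ∈ U i := Opens.mem_iSup.1 h
    refine ⟨fun h => sf (key h.down).choose ⟨(key h.down).choose_spec⟩, fun i => ?_,
      fun t ht => ?_⟩
    · funext h
      have hx : x ∈ iSup U := Opens.mem_iSup.2 ⟨i, h.down⟩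
      exact congrFun (hsf (key hx).choose i) ⟨⟨(key hx).choose_spec, h.down⟩⟩
    · funext h
      exact congrFun (ht (key h.down).choose) ⟨(key h.down).choose_spec⟩

end Sheaf

end TopCat

section

variable {X : TopCat.{u}} {J : Type u₁} [Category.{v₁} J]
  {D : J ⥤ TopCat.Sheaf AddCommGrpCat.{w} X} {c : Cocone D}

theorem map_comp_hom_app_apply {i j k : J} (f : i ⟶ j) (g : j ⟶ k) (U : Opens X)
    (s : (D.obj i).obj.obj (op U)) :
    (D.map (f ≫ g)).hom.app (op U) s =
      (D.map g).hom.app (op U) ((D.map f).hom.app (op U) s) := by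
  rw [D.map_comp]
  rfl

theorem cocone_w_hom_app_apply (c : Cocone D) {i j : J} (f : i ⟶ j) (U : Opens X)
    (s : (D.obj i).obj.obj (op U)) :
    (c.ι.app j).hom.app (op U) ((D.map f).hom.app (op U) s) = (c.ι.app i).hom.app (op U) s := by
  rw [← c.w f]
  rfl

theorem cocone_naturality_hom_apply (c : Cocone D) {j : J} {U V : Opens X} (i : V ⟶ U)
    (s : (D.obj j).obj.obj (op U)) :
    (c.ι.app j).hom.app (op V) ((D.obj j).obj.map i.op s) =
      c.pt.obj.map i.op ((c.ι.app j).hom.app (op U) s) :=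
  Sheaf.naturality_hom_apply (c.ι.app j) i s

variable [IsFiltered J]

/-- The sections of the point of a cocone that locally come from the diagram. -/
def locallyInImage (c : Cocone D) (U : Opens X) : AddSubgroup (c.pt.obj.obj (op U)) where
  carrier := {t | ∀ x ∈ U, ∃ (V : Opens X) (i : V ⟶ U) (j : J) (s : (D.obj j).obj.obj (op V)),
    x ∈ V ∧ (c.ι.app j).hom.app (op V) s = c.pt.obj.map i.op t}
  zero_mem' x hx := ⟨U, 𝟙 U, IsFiltered.nonempty.some, 0, hx, by simp⟩
  neg_mem' {t} ht x hx := by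
    obtain ⟨V, i, j, s, hxV, hs⟩ := ht x hx
    exact ⟨V, i, j, -s, hxV, by rw [map_neg, map_neg, hs]⟩
  add_mem' {t₁ t₂} ht₁ ht₂ x hx := by
    obtain ⟨V₁, i₁, j₁, s₁, hx₁, hs₁⟩ := ht₁ x hx
    obtain ⟨V₂, i₂, j₂, s₂, hx₂, hs₂⟩ := ht₂ x hx
    let a₁ : V₁ ⊓ V₂ ⟶ V₁ := homOfLE inf_le_left
    let a₂ : V₁ ⊓ V₂ ⟶ V₂ := homOfLE inf_le_right
    refine ⟨V₁ ⊓ V₂, a₁ ≫ i₁, IsFiltered.max j₁ j₂,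
      (D.map (IsFiltered.leftToMax j₁ j₂)).hom.app _ ((D.obj j₁).obj.map a₁.op s₁) +
      (D.map (IsFiltered.rightToMax j₁ j₂)).hom.app _ ((D.obj j₂).obj.map a₂.op s₂),
      ⟨hx₁, hx₂⟩, ?_⟩
    rw [map_add, map_add, cocone_w_hom_app_apply, cocone_w_hom_app_apply,
      cocone_naturality_hom_apply, cocone_naturality_hom_apply, hs₁, hs₂,
      Sheaf.map_map_apply _ _ _ (a₁ ≫ i₁), Sheaf.map_map_apply _ _ _ (a₁ ≫ i₁)]

/-- Every section of a filtered colimit of sheaves locally comes from the diagram. -/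
theorem mem_locallyInImage (hc : IsColimit c) (U : Opens X) (t : c.pt.obj.obj (op U)) :
    t ∈ locallyInImage c U := by
  have hS : ∀ {U V : Opens X} (i : V ⟶ U), ∀ t ∈ locallyInImage c U,
      c.pt.obj.map i.op t ∈ locallyInImage c V := by
    intro U V i t ht x hx
    obtain ⟨W, a, j, s, hxW, hs⟩ := ht x (i.le hx)
    let b : W ⊓ V ⟶ W := homOfLE inf_le_left
    let d : W ⊓ V ⟶ V := homOfLE inf_le_right
    refine ⟨W ⊓ V, d, j, (D.obj j).obj.map b.op s, ⟨hxW, hx⟩, ?_⟩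
    rw [cocone_naturality_hom_apply, hs, Sheaf.map_map_apply _ _ _ (d ≫ i),
      Sheaf.map_map_apply _ _ _ (d ≫ i)]
  have hloc : ∀ (U : Opens X) (t : c.pt.obj.obj (op U)),
      (∀ x ∈ U, ∃ (V : Opens X) (i : V ⟶ U), x ∈ V ∧
        c.pt.obj.map i.op t ∈ locallyInImage c V) → t ∈ locallyInImage c U := by
    intro U t ht x hx
    obtain ⟨V, i, hxV, hV⟩ := ht x hx
    obtain ⟨W, a, j, s, hxW, hs⟩ := hV x hxV
    exact ⟨W, a ≫ i, j, s, hxW, by rw [hs, Sheaf.map_map_apply _ _ _ (a ≫ i)]⟩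
  let I := Sheaf.subSheaf (locallyInImage c) hS hloc
  let incl : I ⟶ c.pt := ⟨{ app := fun U => AddCommGrpCat.ofHom (locallyInImage c U.unop).subtype
                            naturality := fun _ _ _ => rfl }⟩
  let d : Cocone D :=
    { pt := I
      ι :=
        { app j := ⟨
            { app U := AddCommGrpCat.ofHom (((c.ι.app j).hom.app U).hom.codRestrict
                (locallyInImage c U.unop) fun s x hx =>
                  ⟨U.unop, 𝟙 _, j, s, hx, (c.pt.map_self_apply _ _).symm⟩)
              naturality U V i := by
                ext s
                exact Subtype.ext (cocone_naturality_hom_apply c i.unop s) }⟩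
          naturality i j f := by
            refine CategoryTheory.Sheaf.hom_ext ?_
            ext U s
            exact Subtype.ext (cocone_w_hom_app_apply c f U.unop s) } }
  have h : hc.desc d ≫ incl = 𝟙 c.pt := hc.hom_ext fun j => by
    rw [hc.fac_assoc, Category.comp_id]
    rfl
  have := congrArg (fun f : c.pt ⟶ c.pt => f.hom.app (op U) t) h
  have e : ((hc.desc d).hom.app (op U) t).1 = t := this
  exact e ▸ ((hc.desc d).hom.app (op U) t).2

/-- A section that becomes zero in the colimit already vanishes at some stage on a neighborhood of
any given point. Otherwise a character of the stalk of the diagram that does not kill the germ of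
the section would define a cocone on a skyscraper sheaf. -/
theorem exists_map_eq_zero_near (hc : IsColimit c) {U : Opens X} {j : J}
    (s : (D.obj j).obj.obj (op U)) (hs : (c.ι.app j).hom.app (op U) s = 0) (x : X) (hx : x ∈ U) :
    ∃ (V : Opens X) (i : V ⟶ U) (k : J) (f : j ⟶ k), x ∈ V ∧
      (D.obj k).obj.map i.op ((D.map f).hom.app (op U) s) = 0 := by
  let G : J × (OpenNhds x)ᵒᵖ ⥤ AddCommGrpCat.{w} :=
    Functor.uncurry.obj (D ⋙ sheafToPresheaf _ _ ⋙
      (Functor.whiskeringLeft _ _ _).obj (OpenNhds.inclusion x).op)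
  let H : AsSmall.{max u₁ v₁ u w} (J × (OpenNhds x)ᵒᵖ) ⥤ AddCommGrpCat.{max u₁ v₁ u w} :=
    AsSmall.down ⋙ G ⋙ AddCommGrpCat.uliftFunctor.{max u₁ v₁ u, w}
  let idx (k : J) (V : Opens X) (hV : x ∈ V) : AsSmall.{max u₁ v₁ u w} (J × (OpenNhds x)ᵒᵖ) :=
    ⟨(k, op ⟨V, hV⟩)⟩
  let γ (k : J) (V : Opens X) (hV : x ∈ V) : (D.obj k).obj.obj (op V) →+ ↑(colimit H) :=
    (colimit.ι H (idx k V hV)).hom.comp AddEquiv.ulift.symm.toAddMonoidHom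
  have hγ (k l : J) (f : k ⟶ l) (V W : Opens X) (i : W ⟶ V) (hV : x ∈ V) (hW : x ∈ W)
      (t : (D.obj k).obj.obj (op V)) :
      γ l W hW ((D.obj l).obj.map i.op ((D.map f).hom.app (op V) t)) = γ k V hV t := by
    let φ : idx k V hV ⟶ idx l W hW := ⟨(f, Quiver.Hom.op (homOfLE i.le))⟩
    exact ConcreteCategory.congr_hom (colimit.w H φ) (ULift.up t)
  by_cases h0 : γ j U hx s = 0
  · have h1 : colimit.ι H (idx j U hx) (ULift.up s) = colimit.ι H (idx j U hx) (ULift.up 0) :=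
      h0.trans (map_zero (γ j U hx)).symm
    obtain ⟨k, f, g, hfg⟩ := (Concrete.colimit_rep_eq_iff_exists H _ _).1 h1
    let k' := AsSmall.down.obj k
    let f' : (j, op ⟨U, hx⟩) ⟶ k' := AsSmall.down.map f
    refine ⟨k'.2.unop.1, (OpenNhds.inclusion x).map f'.2.unop, k'.1, f'.1,
      k'.2.unop.property, ?_⟩
    have h2 : H.map f (ULift.up s) = ULift.up 0 :=
      hfg.trans (map_zero (H.map g).hom)
    exact congrArg ULift.down h2
  · exfalso
    obtain ⟨χ, hχ⟩ := CharacterModule.exists_character_apply_ne_zero_of_ne_zero h0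
    let B := ULift.{w} (AddCircle (1 : ℚ))
    let ψ : ↑(colimit H) →+ B := AddEquiv.ulift.symm.toAddMonoidHom.comp χ
    let d : Cocone D :=
      { pt := Sheaf.skyscraper x B
        ι :=
          { app k := ⟨
              { app V := AddCommGrpCat.ofHom
                  { toFun t h := ψ (γ k V.unop h.down t)
                    map_zero' := by funext h; simp
                    map_add' a b := by funext h; simp }
                naturality V W i := by
                  ext t
                  funext h
                  refine congrArg ψ (Eq.trans ?_ (hγ k k (𝟙 k) V.unop W.unop i.unop
                    (i.unop.le h.down) h.down t))
                  rw [D.map_id]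
                  rfl }⟩
            naturality k l f := by
              refine CategoryTheory.Sheaf.hom_ext ?_
              ext V t
              funext h
              refine congrArg ψ (Eq.trans ?_ (hγ k l f V.unop V.unop (𝟙 _) h.down h.down t))
              rw [Sheaf.map_self_apply]
              rfl } }
    have h1 : (d.ι.app j).hom.app (op U) s = 0 := by
      rw [← hc.fac d j]
      exact (congrArg ((hc.desc d).hom.app (op U)) hs).trans (map_zero _)
    exact hχ (congrArg ULift.down (congrFun h1 ⟨hx⟩))

theorem CategoryTheory.IsFiltered.exists_forall_of_finite {ι : Type*} [Finite ι] {k : J}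
    (Q : ι → ∀ m, (k ⟶ m) → Prop)
    (hQ : ∀ i m n (f : k ⟶ m) (g : m ⟶ n), Q i m f → Q i n (f ≫ g))
    (h : ∀ i, ∃ m f, Q i m f) : ∃ m f, ∀ i, Q i m f := by
  choose m f hf using h
  obtain ⟨n, a, g, hg⟩ := IsFiltered.wideSpan f
  exact ⟨n, a, fun i => hg i ▸ hQ i _ _ _ (g i) (hf i)⟩

theorem TopologicalSpace.NoetherianSpace.exists_finite_subcover [NoetherianSpace X] (U : Opens X)
    (V : U → Opens X) (hV : ∀ x : U, x.1 ∈ V x) :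
    ∃ T : Finset U, U ≤ ⨆ x : T, V x := by
  obtain ⟨T, hT⟩ := (NoetherianSpace.isCompact (U : Set X)).elim_finite_subcover
    (fun x : U => (V x : Set X)) (fun x => (V x).isOpen)
    (fun x hx => Set.mem_iUnion.2 ⟨⟨x, hx⟩, hV _⟩)
  refine ⟨T, fun x hx => ?_⟩
  obtain ⟨y, hy, hxy⟩ := Set.mem_iUnion₂.1 (hT hx)
  exact Opens.mem_iSup.2 ⟨⟨y, hy⟩, hxy⟩

/-- On a noetherian space, a section that becomes zero in a filtered colimit of sheaves vanishes
at some stage of the diagram. -/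
theorem exists_map_eq_zero [NoetherianSpace X] (hc : IsColimit c) {U : Opens X} {j : J}
    (s : (D.obj j).obj.obj (op U)) (hs : (c.ι.app j).hom.app (op U) s = 0) :
    ∃ (k : J) (f : j ⟶ k), (D.map f).hom.app (op U) s = 0 := by
  choose V i k f hxV h using fun x : U => exists_map_eq_zero_near hc s hs x.1 x.2
  obtain ⟨T, hT⟩ := NoetherianSpace.exists_finite_subcover U V hxV
  obtain ⟨m, g, hg⟩ := IsFiltered.exists_forall_of_finite (ι := T)
    (fun x m g => (D.obj m).obj.map (i x).op ((D.map g).hom.app (op U) s) = 0)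
    (fun _ _ _ _ _ hab => by
      rw [map_comp_hom_app_apply, ← Sheaf.naturality_hom_apply, hab, map_zero])
    (fun x => ⟨k x, f x, h x⟩)
  refine ⟨m, g, (D.obj m).eq_of_locally_eq_ab (fun x : T => V x) U (fun x => i x) hT _ _
    fun x => ?_⟩
  rw [hg x, map_zero]

/-- On a noetherian space, every section of a filtered colimit of sheaves comes from some stage
of the diagram. -/
theorem exists_app_eq [NoetherianSpace X] (hc : IsColimit c) {U : Opens X}
    (t : c.pt.obj.obj (op U)) :
    ∃ (j : J) (s : (D.obj j).obj.obj (op U)), (c.ι.app j).hom.app (op U) s = t := by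
  classical
  choose V i j s hxV hs using fun x : U => mem_locallyInImage hc U t x.1 x.2
  obtain ⟨T, hT⟩ := NoetherianSpace.exists_finite_subcover U V hxV
  obtain ⟨k, hk⟩ := IsFiltered.sup_objs_exists (T.image j)
  let f (x : T) : j x ⟶ k := (hk (Finset.mem_image_of_mem j x.2)).some
  let s' (x : T) : (D.obj k).obj.obj (op (V x)) := (D.map (f x)).hom.app _ (s x)
  have hs' (x : T) : (c.ι.app k).hom.app _ (s' x) = c.pt.obj.map (i x).op t := by
    rw [cocone_w_hom_app_apply, hs]
  let a (x y : T) : V x ⊓ V y ⟶ V x := homOfLE inf_le_left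
  let b (x y : T) : V x ⊓ V y ⟶ V y := homOfLE inf_le_right
  obtain ⟨m, g, hg⟩ := IsFiltered.exists_forall_of_finite (ι := T × T) (k := k)
    (fun p m g => (D.map g).hom.app _ ((D.obj k).obj.map (a p.1 p.2).op (s' p.1) -
      (D.obj k).obj.map (b p.1 p.2).op (s' p.2)) = 0)
    (fun _ _ _ _ _ hab => by rw [map_comp_hom_app_apply, hab, map_zero])
    (fun p => exists_map_eq_zero hc _ (by
      rw [map_sub, cocone_naturality_hom_apply, cocone_naturality_hom_apply, hs', hs',
        Sheaf.map_map_apply _ _ _ (a p.1 p.2 ≫ i p.1),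
        Sheaf.map_map_apply _ _ _ (a p.1 p.2 ≫ i p.1), sub_self]))
  obtain ⟨σ, hσ, -⟩ := (D.obj m).existsUnique_gluing_ab (fun x : T => V x) U (fun x => i x) hT
    (fun x => (D.map g).hom.app _ (s' x)) (fun x y => by
      have := hg (x, y)
      rw [map_sub, sub_eq_zero, Sheaf.naturality_hom_apply, Sheaf.naturality_hom_apply] at this
      exact this)
  refine ⟨m, σ, c.pt.eq_of_locally_eq_ab (fun x : T => V x) U (fun x => i x) hT _ _ fun x => ?_⟩
  rw [← cocone_naturality_hom_apply, hσ, cocone_w_hom_app_apply, hs']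

end

end

/-- On a noetherian topological space, the colimit of any filtered diagram of
flabby sheaves of abelian groups is again flabby. -/
theorem stmt_1 (X : TopCat) [TopologicalSpace.NoetherianSpace X]
    (J : Type*) [Category J] [IsFiltered J]
    (D : J ⥤ TopCat.Sheaf Ab X) (hD : ∀ j, IsFlabby (D.obj j))
    (c : Cocone D) (hc : IsColimit c) : IsFlabby c.pt := by
  intro U t
  obtain ⟨j, s, rfl⟩ := exists_app_eq hc t
  obtain ⟨r, rfl⟩ := hD j U s
  exact ⟨(c.ι.app j).hom.app _ r, (cocone_naturality_hom_apply c _ r).symm⟩
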